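/- arXiv:1912.09727 — 6 statements merged into one kernel-verified Lean document; each statement's English description precedes it below -/
import Mathlib

section
/- Suppose Θ = ℝ^n, i.e., X = Ω. Then for every k ∈ ℕ, O_k = {x ∈ ℝ^n : (x,1)ᵀ M (x,1) ≤ 0 for all M ∈ 𝒬_k}, where (x,1) ∈ ℝ^{n+1} denotes x with the entry 1 appended. -/
open Matrix

/-- The value at `(x, 1)` of the quadratic form with blocks `P`, `r`, `rᵀ`, `-1`. -/
theorem sumElim_one_dotProduct_fromBlocks_mulVec {m R : Type*} [Fintype m] [CommRing R]
    (P : Matrix m m R) (r x : m → R) :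
    (Sum.elim x fun _ => (1 : R)) ⬝ᵥ
      (Matrix.fromBlocks P (Matrix.of fun i (_ : Unit) => r i)
        (Matrix.of fun (_ : Unit) j => r j)
        (Matrix.of fun (_ : Unit) (_ : Unit) => (-1 : R))).mulVec (Sum.elim x fun _ => (1 : R)) =
      x ⬝ᵥ P.mulVec x + 2 * (r ⬝ᵥ x) - 1 := by
  have h : x ⬝ᵥ r = r ⬝ᵥ x := dotProduct_comm x r
  simp only [dotProduct] at h
  simp [dotProduct, Matrix.mulVec, mul_add, Finset.sum_add_distrib, h]
  ring

/-- The block-diagonal matrix with blocks `A` and `1` sends `(x, 1)` to `(A x, 1)`. -/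
theorem fromBlocks_one_mulVec_sumElim_one {m R : Type*} [Fintype m] [CommRing R]
    (A : Matrix m m R) (x : m → R) :
    (Matrix.fromBlocks A 0 0 (1 : Matrix Unit Unit R)).mulVec (Sum.elim x fun _ => (1 : R)) =
      Sum.elim (A.mulVec x) fun _ => (1 : R) := by
  rw [Matrix.fromBlocks_mulVec]
  ext (i | i) <;> simp

/-- Evaluating the congruence `Bᵀ * M * B` at `v` is evaluating `M` at `B v`. -/
theorem dotProduct_transpose_mul_mul_mulVec {m R : Type*} [Fintype m] [CommRing R]
    (B M : Matrix m m R) (v : m → R) :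
    v ⬝ᵥ (Bᵀ * M * B).mulVec v = B.mulVec v ⬝ᵥ M.mulVec (B.mulVec v) := by
  rw [← Matrix.mulVec_mulVec, ← Matrix.mulVec_mulVec, Matrix.dotProduct_mulVec,
    Matrix.vecMul_transpose]

/-- With X = Ω given by quadratic constraints, for every k the set O_k equals
{x : (x,1)ᵀ M (x,1) ≤ 0 for all M ∈ 𝒬_k}. -/
theorem Ok_quadratic_representation (n p : ℕ) (A : Matrix (Fin n) (Fin n) ℝ)
    (Q : Fin p → Matrix (Fin n) (Fin n) ℝ) (q : Fin p → Fin n → ℝ)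
    (hQsymm : ∀ i, (Q i)ᵀ = Q i)
    (X : Set (Fin n → ℝ))
    (hX : X = {x : Fin n → ℝ | ∀ i : Fin p, x ⬝ᵥ (Q i).mulVec x + 2 * (q i ⬝ᵥ x) ≤ 1})
    (O : ℕ → Set (Fin n → ℝ)) (hO0 : O 0 = X)
    (hOsucc : ∀ k : ℕ, O (k + 1) = O k ∩ {x : Fin n → ℝ | A.mulVec x ∈ O k})
    (Abar : Matrix (Fin n ⊕ Unit) (Fin n ⊕ Unit) ℝ)
    (hAbar : Abar = Matrix.fromBlocks A 0 0 1)
    (Qbar : Fin p → Matrix (Fin n ⊕ Unit) (Fin n ⊕ Unit) ℝ)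
    (hQbar : ∀ i, Qbar i = Matrix.fromBlocks (Q i) (Matrix.of fun r (_ : Unit) => q i r)
      (Matrix.of fun (_ : Unit) c => q i c) (Matrix.of fun (_ : Unit) (_ : Unit) => (-1 : ℝ)))
    (𝒬 : ℕ → Set (Matrix (Fin n ⊕ Unit) (Fin n ⊕ Unit) ℝ))
    (h𝒬0 : 𝒬 0 = Set.range Qbar)
    (h𝒬succ : ∀ k : ℕ, 𝒬 (k + 1) = 𝒬 k ∪ (fun M => Abarᵀ * M * Abar) '' 𝒬 k)
    (k : ℕ) :
    O k = {x : Fin n → ℝ | ∀ M ∈ 𝒬 k,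
      (Sum.elim x fun _ => (1 : ℝ)) ⬝ᵥ M.mulVec (Sum.elim x fun _ => (1 : ℝ)) ≤ 0} := by
  induction k with
  | zero =>
    ext x
    simp only [hO0, hX, h𝒬0, Set.mem_ofPred_eq, Set.forall_mem_range, hQbar,
      sumElim_one_dotProduct_fromBlocks_mulVec, sub_nonpos]
  | succ k ih =>
    ext x
    simp only [hOsucc, h𝒬succ, ih, Set.mem_inter_iff, Set.mem_ofPred_eq, Set.mem_union, or_imp,
      forall_and, Set.forall_mem_image, dotProduct_transpose_mul_mul_mulVec, hAbar,
      fromBlocks_one_mulVec_sumElim_one]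
end

section
/- Suppose A^k → 0 as k → ∞ (which holds precisely when A is Schur stable, i.e., all complex eigenvalues of A have modulus < 1), Ω is compact with the origin in its interior, Θ = ℝ^n, X = Ω, and Q_1 = (1/D_x) I_n with q_1 = 0 for some D_x > 0 (so the constraint ‖x‖² ≤ D_x appears among the defining constraints of Ω). Then for every i ∈ {1,…,p} there exists k_i ∈ ℕ and a matrix M ∈ cone(𝒬_{k_i}) such that (Ā^{k_i+1})ᵀ Q̄_i Ā^{k_i+1} ⪯ M. -/
open Matrix

/-- The cone (set of nonnegative linear combinations) generated by a set of matrices. -/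
def matCone {α : Type*} [AddCommMonoid α] [Module ℝ α] (S : Set α) : Set α :=
  { M | ∃ (t : Finset α) (c : α → ℝ), (↑t : Set α) ⊆ S ∧ (∀ x ∈ t, 0 ≤ c x) ∧
      M = ∑ x ∈ t, c x • x }

open Filter Topology in
/-- Symmetric matrices converging to a positive diagonal matrix are eventually positive
semidefinite. -/
lemma eventually_posSemidef_of_tendsto_diagonal {ι κ : Type*} [Fintype ι] [DecidableEq ι]
    {l : Filter κ} {M : κ → Matrix ι ι ℝ} {d : ι → ℝ} (hd : ∀ i, 0 < d i)
    (hM : ∀ k, (M k).IsHermitian) (h : Tendsto M l (𝓝 (Matrix.diagonal d))) :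
    ∀ᶠ k in l, (M k).PosSemidef := by
  have hε : ∃ ε > 0, ∀ i, (Fintype.card ι : ℝ) * ε ≤ d i := by
    cases isEmpty_or_nonempty ι
    · exact ⟨1, one_pos, fun i => isEmptyElim i⟩
    · obtain ⟨j, hj⟩ := Finite.exists_min d
      have hc : (0 : ℝ) < Fintype.card ι := by exact_mod_cast Fintype.card_pos
      exact ⟨d j / Fintype.card ι, div_pos (hd j) hc, fun i => by
        rw [mul_div_cancel₀ _ hc.ne']; exact hj i⟩
  obtain ⟨ε, hε0, hε⟩ := hε
  have hent : ∀ᶠ k in l, ∀ i j, |M k i j - Matrix.diagonal d i j| < ε := by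
    refine eventually_all.2 fun i => eventually_all.2 fun j => ?_
    have hij : Tendsto (fun k => M k i j) l (𝓝 (Matrix.diagonal d i j)) :=
      tendsto_pi_nhds.1 (tendsto_pi_nhds.1 h i) j
    exact Metric.tendsto_nhds.1 hij ε hε0
  filter_upwards [hent] with k hk
  refine Matrix.PosSemidef.of_dotProduct_mulVec_nonneg (hM k) fun v => ?_
  have hterm : ∀ i j, v i * Matrix.diagonal d i j * v j - ε * (v i ^ 2 + v j ^ 2) / 2
      ≤ v i * (M k i j * v j) := by
    intro i j
    have h1 := abs_lt.1 (hk i j)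
    nlinarith [mul_nonneg (sub_nonneg.2 h1.1.le) (sq_nonneg (v i + v j)),
      mul_nonneg (sub_nonneg.2 h1.2.le) (sq_nonneg (v i - v j))]
  have hsum := Finset.sum_le_sum fun i (_ : i ∈ Finset.univ) =>
    Finset.sum_le_sum fun j (_ : j ∈ Finset.univ) => hterm i j
  have hlow : 0 ≤ ∑ i, ∑ j, (v i * Matrix.diagonal d i j * v j - ε * (v i ^ 2 + v j ^ 2) / 2) := by
    have heq : ∑ i, ∑ j, (v i * Matrix.diagonal d i j * v j - ε * (v i ^ 2 + v j ^ 2) / 2)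
        = ∑ i, (d i - Fintype.card ι * ε) * v i ^ 2 := by
      have hdiag : ∀ i, ∑ j, v i * Matrix.diagonal d i j * v j = d i * v i ^ 2 := fun i => by
        rw [Finset.sum_eq_single i (fun j _ hj => by simp [Matrix.diagonal_apply_ne' d hj])
          (by simp), Matrix.diagonal_apply_eq]
        ring
      simp only [Finset.sum_sub_distrib, hdiag, mul_add, add_div, Finset.sum_add_distrib,
        Finset.sum_const, Finset.card_univ, nsmul_eq_mul, sub_mul]
      simp only [← Finset.mul_sum, ← Finset.sum_div, mul_assoc]
      ring
    rw [heq]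
    exact Finset.sum_nonneg fun i _ => mul_nonneg (sub_nonneg.2 (hε i)) (sq_nonneg _)
  simpa [dotProduct, Matrix.mulVec, Finset.mul_sum] using hlow.trans hsum

lemma smul_mem_matCone {α : Type*} [AddCommMonoid α] [Module ℝ α] {S : Set α} {x : α}
    (hx : x ∈ S) {r : ℝ} (hr : 0 ≤ r) : r • x ∈ matCone S :=
  ⟨{x}, fun _ => r, by simpa using hx, fun _ _ => hr, by simp⟩

/-- If A is Schur stable (A^k → 0), Ω is compact with 0 in its interior,
X = Ω, and the first quadratic constraint is ‖x‖² ≤ D_x (i.e. Q_1 = (1/D_x)I, q_1 = 0),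
then for every i there is a finite k_i and M ∈ cone(𝒬_{k_i}) with
(Ā^{k_i+1})ᵀ Q̄_i Ā^{k_i+1} ⪯ M. -/
theorem finite_feasibility_quadratic (n p : ℕ) (hp : 0 < p)
    (A : Matrix (Fin n) (Fin n) ℝ)
    (hA : Filter.Tendsto (fun k : ℕ => A ^ k) Filter.atTop (nhds 0))
    (Q : Fin p → Matrix (Fin n) (Fin n) ℝ) (q : Fin p → Fin n → ℝ)
    (hQsymm : ∀ i, (Q i)ᵀ = Q i)
    (Ω : Set (Fin n → ℝ))
    (hΩ : Ω = {x : Fin n → ℝ | ∀ i : Fin p, x ⬝ᵥ (Q i).mulVec x + 2 * (q i ⬝ᵥ x) ≤ 1})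
    (hΩcompact : IsCompact Ω) (hΩint : (0 : Fin n → ℝ) ∈ interior Ω)
    (Dx : ℝ) (hDx : 0 < Dx)
    (hQ1 : Q ⟨0, hp⟩ = (1 / Dx) • (1 : Matrix (Fin n) (Fin n) ℝ))
    (hq1 : q ⟨0, hp⟩ = 0)
    (Abar : Matrix (Fin n ⊕ Unit) (Fin n ⊕ Unit) ℝ)
    (hAbar : Abar = Matrix.fromBlocks A 0 0 1)
    (Qbar : Fin p → Matrix (Fin n ⊕ Unit) (Fin n ⊕ Unit) ℝ)
    (hQbar : ∀ i, Qbar i = Matrix.fromBlocks (Q i) (Matrix.of fun r (_ : Unit) => q i r)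
      (Matrix.of fun (_ : Unit) c => q i c) (Matrix.of fun (_ : Unit) (_ : Unit) => (-1 : ℝ)))
    (𝒬 : ℕ → Set (Matrix (Fin n ⊕ Unit) (Fin n ⊕ Unit) ℝ))
    (h𝒬0 : 𝒬 0 = Set.range Qbar)
    (h𝒬succ : ∀ k : ℕ, 𝒬 (k + 1) = 𝒬 k ∪ (fun M => Abarᵀ * M * Abar) '' 𝒬 k) :
    ∀ i : Fin p, ∃ ki : ℕ, ∃ M ∈ matCone (𝒬 ki),
      (M - (Abar ^ (ki + 1))ᵀ * Qbar i * Abar ^ (ki + 1)).PosSemidef := by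
  intro i
  have hmem : ∀ k, Qbar ⟨0, hp⟩ ∈ 𝒬 k := by
    intro k
    induction k with
    | zero => exact h𝒬0 ▸ Set.mem_range_self _
    | succ k ih => exact h𝒬succ k ▸ Or.inl ih
  have hsymm : ∀ j, (Qbar j)ᵀ = Qbar j := by
    intro j
    rw [hQbar, Matrix.fromBlocks_transpose, hQsymm]
    rfl
  have hpow : ∀ k, Abar ^ k = Matrix.fromBlocks (A ^ k) 0 0 1 := by
    intro k
    rw [hAbar, Matrix.fromBlocks_diagonal_pow, one_pow]
  have hAk : Filter.Tendsto (fun k : ℕ => Abar ^ (k + 1)) Filter.atTop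
      (nhds (Matrix.fromBlocks 0 0 0 1)) := by
    simp only [hpow]
    have hcont : Continuous fun B : Matrix (Fin n) (Fin n) ℝ =>
        (Matrix.fromBlocks B 0 0 1 : Matrix (Fin n ⊕ Unit) (Fin n ⊕ Unit) ℝ) :=
      continuous_id.matrix_fromBlocks continuous_const continuous_const continuous_const
    exact (hcont.tendsto 0).comp (hA.comp (Filter.tendsto_add_atTop_nat 1))
  have hcont : Continuous fun B : Matrix (Fin n ⊕ Unit) (Fin n ⊕ Unit) ℝ =>
      (1 / 2 : ℝ) • Qbar ⟨0, hp⟩ - Bᵀ * Qbar i * B := by fun_prop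
  have hlim := (hcont.tendsto _).comp hAk
  have hdiag : (1 / 2 : ℝ) • Qbar ⟨0, hp⟩ -
      (Matrix.fromBlocks 0 0 0 1 : Matrix (Fin n ⊕ Unit) (Fin n ⊕ Unit) ℝ)ᵀ * Qbar i *
        Matrix.fromBlocks 0 0 0 1 =
      Matrix.diagonal (Sum.elim (fun _ => 1 / (2 * Dx)) fun _ => 1 / 2) := by
    rw [hQbar, hQbar, hQ1, hq1, Matrix.fromBlocks_transpose, Matrix.fromBlocks_multiply,
      Matrix.fromBlocks_multiply]
    ext (a | a) (b | b)
    · by_cases hab : a = b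
      · subst hab
        simp
        ring
      · simp [hab]
    · simp
    · simp
    · simp
      norm_num
  rw [hdiag] at hlim
  have hd : ∀ j : Fin n ⊕ Unit, 0 < Sum.elim (fun _ => 1 / (2 * Dx)) (fun _ => (1 / 2 : ℝ)) j := by
    rintro (j | j)
    · exact one_div_pos.2 (by positivity)
    · exact one_half_pos
  obtain ⟨k, hk⟩ := (eventually_posSemidef_of_tendsto_diagonal hd (fun k => by
    simp [Matrix.IsHermitian, Matrix.conjTranspose_eq_transpose_of_trivial,
      Matrix.transpose_mul, hsymm, Matrix.mul_assoc]) hlim).exists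
  exact ⟨k, _, smul_mem_matCone (hmem k) one_half_pos.le, hk⟩
end

section
/- (Exactness in the linear-constraint case.) Suppose A^k → 0 as k → ∞ (equivalently, A is Schur stable), Θ = ℝ^n, Q_i = 0 for all i = 1,…,p, so that X = {x ∈ ℝ^n : 2 q_iᵀ x ≤ 1, i = 1,…,p} is a polyhedron, and suppose X is compact with the origin in its interior. Then for every k ∈ ℕ, the following are equivalent: (a) for every Q ∈ 𝒬_{k+1} \ 𝒬_k there exists M ∈ cone(𝒬_k) with Q ⪯ M; (b) O_{k+1} = O_k. -/
open Matrix

/-- The matrix of the affine constraint `2 vᵀ x ≤ 1`, as a quadratic form in `(x, 1)`. -/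
def constraintMatrix {ι : Type*} (v : ι → ℝ) : Matrix (ι ⊕ Unit) (ι ⊕ Unit) ℝ :=
  Matrix.fromBlocks 0 (Matrix.of fun r _ => v r) (Matrix.of fun _ c => v c)
    (Matrix.of fun _ _ => -1)

/-- The polyhedron cut out by the constraints `2 vᵀ x ≤ 1`, `v ∈ V`. -/
def constraintSet {ι : Type*} [Fintype ι] (V : Set (ι → ℝ)) : Set (ι → ℝ) :=
  {x | ∀ v ∈ V, 2 * (v ⬝ᵥ x) ≤ 1}

/-- The constraint vectors `(Aᵀ)ʲ v`, `v ∈ V`, `j ≤ k`. -/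
def iteratedConstraints {ι : Type*} [Fintype ι] (A : Matrix ι ι ℝ) (V : Set (ι → ℝ)) :
    ℕ → Set (ι → ℝ)
  | 0 => V
  | k + 1 => iteratedConstraints A V k ∪ (Aᵀ *ᵥ ·) '' iteratedConstraints A V k

section

variable {ι : Type*}

theorem constraintMatrix_injective :
    Function.Injective (constraintMatrix : (ι → ℝ) → Matrix (ι ⊕ Unit) (ι ⊕ Unit) ℝ) := by
  intro v w h
  ext r
  exact congrFun (congrFun h (Sum.inl r)) (Sum.inr ())

variable [Fintype ι]

theorem iteratedConstraints_finite (A : Matrix ι ι ℝ) {V : Set (ι → ℝ)} (hV : V.Finite) (k : ℕ) :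
    (iteratedConstraints A V k).Finite := by
  induction k with
  | zero => exact hV
  | succ k ih => exact ih.union (ih.image _)

theorem quadForm_constraintMatrix (v x : ι → ℝ) :
    Sum.elim x (fun _ : Unit => (1 : ℝ)) ⬝ᵥ
      (constraintMatrix v *ᵥ Sum.elim x (fun _ : Unit => (1 : ℝ))) = 2 * (v ⬝ᵥ x) - 1 := by
  simp [constraintMatrix, dotProduct, mulVec, Fintype.sum_sum_type, mul_comm]
  ring

theorem transpose_mul_constraintMatrix_mul [DecidableEq ι] (A : Matrix ι ι ℝ) (v : ι → ℝ) :
    (fromBlocks A 0 0 (1 : Matrix Unit Unit ℝ))ᵀ * constraintMatrix v * fromBlocks A 0 0 1 =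
      constraintMatrix (Aᵀ *ᵥ v) := by
  simp only [constraintMatrix, fromBlocks_transpose, fromBlocks_multiply]
  ext (i | i) (j | j) <;> simp [mul_apply, mulVec, dotProduct, mul_comm]

/-- Domination by the cone of constraint matrices makes the constraint redundant. -/
theorem two_mul_dotProduct_le_one_of_posSemidef {V : Set (ι → ℝ)} {v x : ι → ℝ}
    {M : Matrix (ι ⊕ Unit) (ι ⊕ Unit) ℝ} (hM : M ∈ matCone (constraintMatrix '' V))
    (hpos : (M - constraintMatrix v).PosSemidef) (hx : x ∈ constraintSet V) :
    2 * (v ⬝ᵥ x) ≤ 1 := by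
  obtain ⟨t, c, ht, hc, rfl⟩ := hM
  have h := hpos.dotProduct_mulVec_nonneg (Sum.elim x (fun _ : Unit => (1 : ℝ)))
  rw [star_trivial, sub_mulVec, dotProduct_sub, quadForm_constraintMatrix, sum_mulVec,
    dotProduct_sum] at h
  have hsum : ∑ Q ∈ t, Sum.elim x (fun _ : Unit => (1 : ℝ)) ⬝ᵥ
      ((c Q • Q) *ᵥ Sum.elim x (fun _ : Unit => (1 : ℝ))) ≤ 0 := by
    refine Finset.sum_nonpos fun Q hQ => ?_
    obtain ⟨w, hw, rfl⟩ := ht hQ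
    rw [smul_mulVec, dotProduct_smul, quadForm_constraintMatrix]
    exact mul_nonpos_of_nonneg_of_nonpos (hc _ hQ) (by linarith [hx w hw])
  linarith

/-- A version of the affine Farkas lemma: a redundant constraint vector is a convex combination of
`0` and the constraint vectors. -/
theorem mem_convexHull_insert_zero {V : Set (ι → ℝ)} (hV : V.Finite) {v : ι → ℝ}
    (hv : ∀ x ∈ constraintSet V, 2 * (v ⬝ᵥ x) ≤ 1) : v ∈ convexHull ℝ (insert 0 V) := by
  classical
  by_contra hnot
  obtain ⟨f, s, hfs, hsv⟩ := geometric_hahn_banach_closed_point (convex_convexHull ℝ (insert 0 V))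
    ((hV.insert 0).isClosed_convexHull ℝ) hnot
  have hs : 0 < s := by
    simpa using hfs 0 (subset_convexHull ℝ _ (Set.mem_insert _ _))
  set x : ι → ℝ := fun i => f (Pi.single i 1) with hxdef
  have hf : ∀ w : ι → ℝ, f w = w ⬝ᵥ x := by
    intro w
    conv_lhs => rw [pi_eq_sum_univ' w]
    simp only [map_sum, map_smul, smul_eq_mul, dotProduct, hxdef, Pi.single]
  have hx : (2 * s)⁻¹ • x ∈ constraintSet V := by
    intro w hw
    have := hfs w (subset_convexHull ℝ _ (Set.mem_insert_of_mem _ hw))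
    rw [hf] at this
    rw [dotProduct_smul, smul_eq_mul]
    field_simp
    exact this.le
  have := hv _ hx
  rw [dotProduct_smul, smul_eq_mul] at this
  rw [hf] at hsv
  field_simp at this
  linarith

/-- A redundant constraint is dominated by the cone of constraint matrices. -/
theorem exists_mem_matCone_posSemidef {V : Set (ι → ℝ)} (hV : V.Finite) {v : ι → ℝ}
    (hv : ∀ x ∈ constraintSet V, 2 * (v ⬝ᵥ x) ≤ 1) :
    ∃ M ∈ matCone (constraintMatrix '' V), (M - constraintMatrix v).PosSemidef := by
  classical
  have hmem := mem_convexHull_insert_zero hV hv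
  lift V to Finset (ι → ℝ) using hV
  rw [← Finset.coe_insert, Finset.mem_convexHull'] at hmem
  obtain ⟨w, hw0, hw1, hwv⟩ := hmem
  have hle : ∑ y ∈ V, w y ≤ 1 := by
    rw [← hw1]
    exact Finset.sum_le_sum_of_subset_of_nonneg (Finset.subset_insert _ _) fun y hy _ => hw0 y hy
  have hsum : ∑ y ∈ V, w y • y = v := by
    rw [← hwv]
    refine (Finset.sum_insert_of_eq_zero_if_notMem fun _ => ?_).symm
    exact smul_zero _
  refine ⟨∑ y ∈ V, w y • constraintMatrix y,
    ⟨V.image constraintMatrix, fun M => w fun r => M (Sum.inl r) (Sum.inr ()), by simp, ?_, ?_⟩, ?_⟩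
  · simp only [Finset.forall_mem_image]
    exact fun y hy => hw0 y (Finset.mem_insert_of_mem hy)
  · rw [Finset.sum_image constraintMatrix_injective.injOn]
    rfl
  · have hdiag : ∑ y ∈ V, w y • constraintMatrix y - constraintMatrix v =
        diagonal (Sum.elim 0 fun _ : Unit => 1 - ∑ y ∈ V, w y) := by
      rw [← hsum]
      ext (i | i) (j | j) <;>
        simp [constraintMatrix, Matrix.sum_apply, Finset.sum_apply, diagonal_apply] <;> ring
    rw [hdiag, posSemidef_diagonal_iff]
    rintro (i | i) <;> simp [hle]

theorem constraintSet_union_image (A : Matrix ι ι ℝ) (V : Set (ι → ℝ)) :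
    constraintSet (V ∪ (Aᵀ *ᵥ ·) '' V) =
      constraintSet V ∩ {x | A *ᵥ x ∈ constraintSet V} := by
  ext x
  simp only [constraintSet, Set.mem_inter_iff, Set.mem_ofPred_eq, Set.mem_union, or_imp,
    forall_and, Set.forall_mem_image, mulVec_transpose, dotProduct_mulVec]

end

/-- Exactness in the linear-constraint case: with Q_i = 0 (so X is the polyhedron
{x : 2 q_iᵀ x ≤ 1}), X compact with 0 in its interior, and A Schur stable, for every
k the LMI condition (every Q ∈ 𝒬_{k+1} \ 𝒬_k dominated by some M ∈ cone(𝒬_k)) holds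
if and only if O_{k+1} = O_k. -/
theorem exactness_linear_case (n p : ℕ)
    (A : Matrix (Fin n) (Fin n) ℝ)
    (hA : Filter.Tendsto (fun k : ℕ => A ^ k) Filter.atTop (nhds 0))
    (q : Fin p → Fin n → ℝ)
    (X : Set (Fin n → ℝ))
    (hX : X = {x : Fin n → ℝ | ∀ i : Fin p, 2 * (q i ⬝ᵥ x) ≤ 1})
    (hXcompact : IsCompact X) (hXint : (0 : Fin n → ℝ) ∈ interior X)
    (O : ℕ → Set (Fin n → ℝ)) (hO0 : O 0 = X)
    (hOsucc : ∀ k : ℕ, O (k + 1) = O k ∩ {x : Fin n → ℝ | A.mulVec x ∈ O k})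
    (Abar : Matrix (Fin n ⊕ Unit) (Fin n ⊕ Unit) ℝ)
    (hAbar : Abar = Matrix.fromBlocks A 0 0 1)
    (Qbar : Fin p → Matrix (Fin n ⊕ Unit) (Fin n ⊕ Unit) ℝ)
    (hQbar : ∀ i, Qbar i = Matrix.fromBlocks (0 : Matrix (Fin n) (Fin n) ℝ)
      (Matrix.of fun r (_ : Unit) => q i r)
      (Matrix.of fun (_ : Unit) c => q i c) (Matrix.of fun (_ : Unit) (_ : Unit) => (-1 : ℝ)))
    (𝒬 : ℕ → Set (Matrix (Fin n ⊕ Unit) (Fin n ⊕ Unit) ℝ))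
    (h𝒬0 : 𝒬 0 = Set.range Qbar)
    (h𝒬succ : ∀ k : ℕ, 𝒬 (k + 1) = 𝒬 k ∪ (fun M => Abarᵀ * M * Abar) '' 𝒬 k)
    (k : ℕ) :
    (∀ Q' ∈ 𝒬 (k + 1) \ 𝒬 k, ∃ M ∈ matCone (𝒬 k), (M - Q').PosSemidef) ↔
      O (k + 1) = O k := by
  have hL : ∀ i, Qbar i = constraintMatrix (q i) := hQbar
  set W := iteratedConstraints A (Set.range q) with hW
  have hWsucc : ∀ k, W (k + 1) = W k ∪ (Aᵀ *ᵥ ·) '' W k := fun _ => rfl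
  have hOW : ∀ k, O k = constraintSet (W k) := by
    intro k
    induction k with
    | zero =>
      rw [hO0, hX]
      ext x
      simp [hW, iteratedConstraints, constraintSet]
    | succ k ih => rw [hOsucc, ih, hWsucc, constraintSet_union_image]
  have h𝒬W : ∀ k, 𝒬 k = constraintMatrix '' W k := by
    intro k
    induction k with
    | zero =>
      rw [h𝒬0, funext hL]
      exact Set.range_comp constraintMatrix q
    | succ k ih =>
      rw [h𝒬succ, ih, hWsucc, Set.image_union, Set.image_image, Set.image_image, hAbar]
      simp only [transpose_mul_constraintMatrix_mul]
  rw [hOW, hOW, h𝒬W, h𝒬W]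
  constructor
  · intro h
    refine Set.Subset.antisymm (fun x hx v hv => hx v (Or.inl hv)) fun x hx v hv => ?_
    by_cases hvk : v ∈ W k
    · exact hx v hvk
    · obtain ⟨M, hM, hpos⟩ := h (constraintMatrix v)
        ⟨Set.mem_image_of_mem _ hv, fun hmem =>
          hvk (constraintMatrix_injective.mem_set_image.1 hmem)⟩
      exact two_mul_dotProduct_le_one_of_posSemidef hM hpos hx
  · rintro h _ ⟨⟨v, hv, rfl⟩, -⟩
    exact exists_mem_matCone_posSemidef (iteratedConstraints_finite A (Set.finite_range q) k)
      fun x hx => (h ▸ hx : x ∈ constraintSet (W (k + 1))) v hv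
end

section
/- (S-procedure with nonlinear constraints, quadratic part.) Under Assumption Q, fix k ∈ ℕ and i ∈ {1,…,p}. If there exists M ∈ cone(𝒬_k ∪ ℋ^l_k) with (Ā^{k+1})ᵀ Q̄_i Ā^{k+1} ⪯ M, then (x,1)ᵀ (Ā^{k+1})ᵀ Q̄_i Ā^{k+1} (x,1) ≤ 0 for every x ∈ O_k; equivalently, (A^{k+1}x)ᵀ Q_i (A^{k+1}x) + 2 q_iᵀ A^{k+1} x ≤ 1 for every x ∈ O_k. -/
open Matrix

/-- The vector `(x, 1)`. -/
local notation "lift₁" x:max => (Sum.elim x fun _ : Unit => (1 : ℝ))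

theorem dotProduct_congruence_mulVec {ι : Type*} [Fintype ι] (B M : Matrix ι ι ℝ) (v : ι → ℝ) :
    v ⬝ᵥ (Bᵀ * M * B) *ᵥ v = (B *ᵥ v) ⬝ᵥ M *ᵥ (B *ᵥ v) := by
  rw [← mulVec_mulVec, ← mulVec_mulVec, dotProduct_mulVec, vecMul_transpose]

theorem dotProduct_mulVec_nonpos_of_mem_matCone {ι : Type*} [Fintype ι]
    {S : Set (Matrix ι ι ℝ)} {v : ι → ℝ} (hS : ∀ M ∈ S, v ⬝ᵥ M *ᵥ v ≤ 0)
    {M : Matrix ι ι ℝ} (hM : M ∈ matCone S) : v ⬝ᵥ M *ᵥ v ≤ 0 := by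
  obtain ⟨t, c, htS, hc, rfl⟩ := hM
  rw [sum_mulVec, dotProduct_sum]
  refine Finset.sum_nonpos fun N hN => ?_
  rw [smul_mulVec, dotProduct_smul, smul_eq_mul]
  exact mul_nonpos_of_nonneg_of_nonpos (hc N hN) (hS N (htS hN))

theorem fromBlocks_one_mulVec_lift {n : ℕ} (A : Matrix (Fin n) (Fin n) ℝ) (x : Fin n → ℝ) :
    (fromBlocks A 0 0 (1 : Matrix Unit Unit ℝ)) *ᵥ (lift₁ x) = lift₁ (A *ᵥ x) := by
  simp only [fromBlocks_mulVec, Sum.elim_comp_inl, Sum.elim_comp_inr, zero_mulVec, one_mulVec,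
    add_zero, zero_add]

theorem fromBlocks_one_pow_mulVec_lift {n : ℕ} (A : Matrix (Fin n) (Fin n) ℝ) (x : Fin n → ℝ)
    (j : ℕ) :
    ((fromBlocks A 0 0 (1 : Matrix Unit Unit ℝ)) ^ j) *ᵥ (lift₁ x) = lift₁ ((A ^ j) *ᵥ x) := by
  induction j with
  | zero => simp
  | succ j ih => rw [pow_succ', ← mulVec_mulVec, ih, fromBlocks_one_mulVec_lift, pow_succ',
      mulVec_mulVec]

theorem lift_dotProduct_fromBlocks_mulVec {n : ℕ} (P : Matrix (Fin n) (Fin n) ℝ)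
    (b x : Fin n → ℝ) (c : ℝ) :
    (lift₁ x) ⬝ᵥ (fromBlocks P (of fun r (_ : Unit) => b r) (of fun (_ : Unit) r => b r)
      (of fun (_ : Unit) (_ : Unit) => c)) *ᵥ (lift₁ x) = x ⬝ᵥ P *ᵥ x + 2 * (b ⬝ᵥ x) + c := by
  have h₁ : (of fun r (_ : Unit) => b r) *ᵥ (fun _ : Unit => (1 : ℝ)) = b := by
    ext; simp [mulVec, dotProduct]
  have h₂ : (of fun (_ : Unit) r => b r) *ᵥ x = fun _ => b ⬝ᵥ x := rfl
  have h₃ : (of fun (_ : Unit) (_ : Unit) => c) *ᵥ (fun _ : Unit => (1 : ℝ)) = fun _ => c := by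
    ext; simp [mulVec, dotProduct]
  have h₄ (u v : Unit → ℝ) : u ⬝ᵥ v = u () * v () := by simp [dotProduct]
  simp only [fromBlocks_mulVec, Sum.elim_comp_inl, Sum.elim_comp_inr,
    sumElim_dotProduct_sumElim, h₁, h₂, h₃, h₄, dotProduct_add, Pi.add_apply]
  rw [dotProduct_comm x b]
  ring

/-- Pulling constraints back along the dynamics preserves their validity on the iterated
admissible sets. -/
theorem lift_dotProduct_mulVec_nonpos_of_iterate {n : ℕ} (A : Matrix (Fin n) (Fin n) ℝ)
    {O : ℕ → Set (Fin n → ℝ)}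
    (hO : ∀ k : ℕ, O (k + 1) = O k ∩ {x : Fin n → ℝ | A *ᵥ x ∈ O k})
    {S : ℕ → Set (Matrix (Fin n ⊕ Unit) (Fin n ⊕ Unit) ℝ)}
    (hS : ∀ k : ℕ, S (k + 1) = S k ∪
      (fun M => (fromBlocks A 0 0 1)ᵀ * M * (fromBlocks A 0 0 1)) '' S k)
    (h : ∀ x ∈ O 0, ∀ M ∈ S 0, (lift₁ x) ⬝ᵥ M *ᵥ (lift₁ x) ≤ 0) (k : ℕ) :
    ∀ x ∈ O k, ∀ M ∈ S k, (lift₁ x) ⬝ᵥ M *ᵥ (lift₁ x) ≤ 0 := by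
  induction k with
  | zero => exact h
  | succ k ih =>
    intro x hx M hM
    rw [hO] at hx
    rw [hS] at hM
    obtain hM | ⟨N, hN, rfl⟩ := hM
    · exact ih x hx.1 M hM
    · simp only [dotProduct_congruence_mulVec, fromBlocks_one_mulVec_lift]
      exact ih _ hx.2 N hN

/-- S-procedure with nonlinear constraints, quadratic part: if
(Ā^{k+1})ᵀ Q̄_i Ā^{k+1} is dominated by an element of cone(𝒬_k ∪ ℋ^l_k),
then (x,1)ᵀ (Ā^{k+1})ᵀ Q̄_i Ā^{k+1} (x,1) ≤ 0 for every x ∈ O_k; equivalently,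
(A^{k+1}x)ᵀ Q_i (A^{k+1}x) + 2 q_iᵀ A^{k+1} x ≤ 1 on O_k. -/
theorem sProcedure_nonlinear_quadratic_part (n p m : ℕ)
    (A : Matrix (Fin n) (Fin n) ℝ)
    (Q : Fin p → Matrix (Fin n) (Fin n) ℝ) (q : Fin p → Fin n → ℝ)
    (hQsymm : ∀ i, (Q i)ᵀ = Q i)
    (Ω : Set (Fin n → ℝ))
    (hΩ : Ω = {x : Fin n → ℝ | ∀ i : Fin p, x ⬝ᵥ (Q i).mulVec x + 2 * (q i ⬝ᵥ x) ≤ 1})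
    (H : Fin m → (Fin n → ℝ) → ℝ)
    (hHcont : ∀ i, Continuous (H i)) (hH0 : ∀ i, H i 0 = 0)
    (G : Fin m → Fin n → ℝ) (L : Fin m → ℝ) (hL : ∀ i, 0 ≤ L i)
    (hquasi : ∀ i : Fin m, ∀ x ∈ Ω, |H i x - H i 0 - G i ⬝ᵥ x| ≤ L i / 2 * (x ⬝ᵥ x))
    (Θ : Set (Fin n → ℝ)) (hΘ : Θ = {x : Fin n → ℝ | ∀ i : Fin m, H i x ≤ 1})
    (X : Set (Fin n → ℝ)) (hX : X = Ω ∩ Θ)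
    (O : ℕ → Set (Fin n → ℝ)) (hO0 : O 0 = X)
    (hOsucc : ∀ k : ℕ, O (k + 1) = O k ∩ {x : Fin n → ℝ | A.mulVec x ∈ O k})
    (Abar : Matrix (Fin n ⊕ Unit) (Fin n ⊕ Unit) ℝ)
    (hAbar : Abar = Matrix.fromBlocks A 0 0 1)
    (Qbar : Fin p → Matrix (Fin n ⊕ Unit) (Fin n ⊕ Unit) ℝ)
    (hQbar : ∀ i, Qbar i = Matrix.fromBlocks (Q i) (Matrix.of fun r (_ : Unit) => q i r)
      (Matrix.of fun (_ : Unit) c => q i c) (Matrix.of fun (_ : Unit) (_ : Unit) => (-1 : ℝ)))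
    (Hlbar : Fin m → Matrix (Fin n ⊕ Unit) (Fin n ⊕ Unit) ℝ)
    (hHlbar : ∀ i, Hlbar i = Matrix.fromBlocks (-(L i / 2) • (1 : Matrix (Fin n) (Fin n) ℝ))
      (Matrix.of fun r (_ : Unit) => G i r / 2)
      (Matrix.of fun (_ : Unit) c => G i c / 2)
      (Matrix.of fun (_ : Unit) (_ : Unit) => H i 0 - 1))
    (𝒬 : ℕ → Set (Matrix (Fin n ⊕ Unit) (Fin n ⊕ Unit) ℝ))
    (h𝒬0 : 𝒬 0 = Set.range Qbar)
    (h𝒬succ : ∀ k : ℕ, 𝒬 (k + 1) = 𝒬 k ∪ (fun M => Abarᵀ * M * Abar) '' 𝒬 k)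
    (ℋl : ℕ → Set (Matrix (Fin n ⊕ Unit) (Fin n ⊕ Unit) ℝ))
    (hℋl0 : ℋl 0 = Set.range Hlbar)
    (hℋlsucc : ∀ k : ℕ, ℋl (k + 1) = ℋl k ∪ (fun M => Abarᵀ * M * Abar) '' ℋl k)
    (k : ℕ) (i : Fin p)
    (hfeas : ∃ M ∈ matCone (𝒬 k ∪ ℋl k),
      (M - (Abar ^ (k + 1))ᵀ * Qbar i * Abar ^ (k + 1)).PosSemidef) :
    (∀ x ∈ O k,
      (Sum.elim x fun _ => (1 : ℝ)) ⬝ᵥ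
        ((Abar ^ (k + 1))ᵀ * Qbar i * Abar ^ (k + 1)).mulVec
          (Sum.elim x fun _ => (1 : ℝ)) ≤ 0) ∧
    (∀ x ∈ O k,
      ((A ^ (k + 1)).mulVec x) ⬝ᵥ (Q i).mulVec ((A ^ (k + 1)).mulVec x) +
        2 * (q i ⬝ᵥ (A ^ (k + 1)).mulVec x) ≤ 1) := by
  subst hAbar hX
  have hQ₀ : ∀ x ∈ O 0, ∀ M ∈ 𝒬 0, (lift₁ x) ⬝ᵥ M *ᵥ (lift₁ x) ≤ 0 := by
    intro x hx M hM
    rw [hO0, hΩ] at hx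
    rw [h𝒬0] at hM
    obtain ⟨j, rfl⟩ := hM
    rw [hQbar, lift_dotProduct_fromBlocks_mulVec]
    linarith [hx.1 j]
  have hH₀ : ∀ x ∈ O 0, ∀ M ∈ ℋl 0, (lift₁ x) ⬝ᵥ M *ᵥ (lift₁ x) ≤ 0 := by
    intro x hx M hM
    rw [hO0, hΘ] at hx
    rw [hℋl0] at hM
    obtain ⟨j, rfl⟩ := hM
    rw [hHlbar, lift_dotProduct_fromBlocks_mulVec (x := x) (b := fun r => G j r / 2)]
    have hG : (fun r => G j r / 2) ⬝ᵥ x = G j ⬝ᵥ x / 2 := by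
      simp only [dotProduct, Finset.sum_div]
      exact Finset.sum_congr rfl fun _ _ => by ring
    rw [hG, smul_mulVec, one_mulVec, dotProduct_smul, smul_eq_mul]
    linarith [(abs_le.mp (hquasi j x hx.1)).1, hx.2 j]
  have main : ∀ x ∈ O k, (lift₁ x) ⬝ᵥ (((fromBlocks A 0 0 1) ^ (k + 1))ᵀ * Qbar i *
      (fromBlocks A 0 0 1) ^ (k + 1)) *ᵥ (lift₁ x) ≤ 0 := by
    intro x hx
    obtain ⟨M, hM, hpsd⟩ := hfeas
    have hM₀ : (lift₁ x) ⬝ᵥ M *ᵥ (lift₁ x) ≤ 0 := by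
      refine dotProduct_mulVec_nonpos_of_mem_matCone ?_ hM
      rintro N (hN | hN)
      · exact lift_dotProduct_mulVec_nonpos_of_iterate A hOsucc h𝒬succ hQ₀ k x hx N hN
      · exact lift_dotProduct_mulVec_nonpos_of_iterate A hOsucc hℋlsucc hH₀ k x hx N hN
    have hdiff := hpsd.dotProduct_mulVec_nonneg (lift₁ x)
    rw [star_trivial, sub_mulVec, dotProduct_sub] at hdiff
    linarith
  refine ⟨main, fun x hx => ?_⟩
  have h := main x hx
  rw [dotProduct_congruence_mulVec, fromBlocks_one_pow_mulVec_lift, hQbar,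
    lift_dotProduct_fromBlocks_mulVec] at h
  linarith
end

section
/- (S-procedure with nonlinear constraints, nonlinear part.) Suppose the two-sided quadratic bound |H_i(x) − H_i(0) − (H_i^∇)ᵀ x| ≤ (L_i/2)‖x‖² holds for all x ∈ ℝ^n (e.g., when H_i is continuously differentiable with L_i-Lipschitz gradient). Fix k ∈ ℕ and i ∈ {1,…,m}. If there exists M ∈ cone(𝒬_k ∪ ℋ^l_k) with (Ā^{k+1})ᵀ H̄_i^u Ā^{k+1} ⪯ M, then H_i(A^{k+1} x) ≤ 1 for every x ∈ O_k. -/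
open Matrix

/-- The affine embedding `x ↦ (x, 1)`. -/
def homogenize {ι : Type*} (x : ι → ℝ) : ι ⊕ Unit → ℝ := Sum.elim x fun _ => 1

/-- The quadratic function `x ↦ (x, 1)ᵀ M (x, 1)`. -/
def homogenizedForm {ι : Type*} [Fintype ι] (M : Matrix (ι ⊕ Unit) (ι ⊕ Unit) ℝ) (x : ι → ℝ) : ℝ :=
  homogenize x ⬝ᵥ M *ᵥ homogenize x

section homogenizedForm

variable {ι : Type*} [Fintype ι]

theorem homogenizedForm_fromBlocks (P : Matrix ι ι ℝ) (v : ι → ℝ) (s : ℝ) (x : ι → ℝ) :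
    homogenizedForm (Matrix.fromBlocks P (Matrix.of fun r (_ : Unit) => v r)
      (Matrix.of fun (_ : Unit) c => v c) (Matrix.of fun (_ : Unit) (_ : Unit) => s)) x =
      x ⬝ᵥ P *ᵥ x + 2 * (v ⬝ᵥ x) + s := by
  have hcol : (Matrix.of fun r (_ : Unit) => v r) *ᵥ (fun _ => (1 : ℝ)) = v := by
    ext r; simp [mulVec, dotProduct]
  have hrow : (Matrix.of fun (_ : Unit) c => v c) *ᵥ x = fun _ => v ⬝ᵥ x := rfl
  have hcorner : (Matrix.of fun (_ : Unit) (_ : Unit) => s) *ᵥ (fun _ => (1 : ℝ)) = fun _ => s := by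
    ext r; simp [mulVec, dotProduct]
  simp only [homogenizedForm, homogenize, fromBlocks_mulVec, Sum.elim_comp_inl, Sum.elim_comp_inr,
    hcol, hrow, hcorner, sumElim_dotProduct_sumElim, dotProduct_add]
  rw [dotProduct_comm x v]
  simp [dotProduct]
  ring

theorem homogenizedForm_congruence (B M : Matrix (ι ⊕ Unit) (ι ⊕ Unit) ℝ) {x y : ι → ℝ}
    (h : B *ᵥ homogenize x = homogenize y) :
    homogenizedForm (Bᵀ * M * B) x = homogenizedForm M y := by
  rw [homogenizedForm, homogenizedForm, ← mulVec_mulVec, ← mulVec_mulVec, h, dotProduct_mulVec,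
    vecMul_transpose, h]

theorem fromBlocks_one_mulVec_homogenize (A : Matrix ι ι ℝ) (x : ι → ℝ) :
    Matrix.fromBlocks A 0 0 1 *ᵥ homogenize x = homogenize (A *ᵥ x) := by
  simp [homogenize, fromBlocks_mulVec]

theorem fromBlocks_one_pow_mulVec_homogenize [DecidableEq ι] (A : Matrix ι ι ℝ) (k : ℕ)
    (x : ι → ℝ) :
    Matrix.fromBlocks A 0 0 1 ^ k *ᵥ homogenize x = homogenize ((A ^ k) *ᵥ x) := by
  induction k with
  | zero => simp
  | succ k ih =>
    rw [pow_succ', pow_succ', ← mulVec_mulVec, ih, fromBlocks_one_mulVec_homogenize, mulVec_mulVec]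

theorem homogenizedForm_nonpos_of_mem_matCone {S : Set (Matrix (ι ⊕ Unit) (ι ⊕ Unit) ℝ)}
    {x : ι → ℝ} (hS : ∀ M ∈ S, homogenizedForm M x ≤ 0) {M : Matrix (ι ⊕ Unit) (ι ⊕ Unit) ℝ}
    (hM : M ∈ matCone S) : homogenizedForm M x ≤ 0 := by
  obtain ⟨t, c, htS, hc, rfl⟩ := hM
  rw [homogenizedForm, sum_mulVec, dotProduct_sum]
  refine Finset.sum_nonpos fun N hN => ?_
  rw [smul_mulVec, dotProduct_smul]
  exact mul_nonpos_of_nonneg_of_nonpos (hc N hN) (hS N (htS hN))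

theorem homogenizedForm_le_of_posSemidef_sub {M N : Matrix (ι ⊕ Unit) (ι ⊕ Unit) ℝ}
    (h : (M - N).PosSemidef) (x : ι → ℝ) : homogenizedForm N x ≤ homogenizedForm M x := by
  have := h.dotProduct_mulVec_nonneg (homogenize x)
  rwa [star_trivial, sub_mulVec, dotProduct_sub, sub_nonneg] at this

/-- If every form in `S 0` is nonpositive on `O 0`, the same holds after `k` joint pullbacks of the
forms and of the set along the linear map `A`. -/
theorem homogenizedForm_nonpos_of_pullback (A : Matrix ι ι ℝ) {O : ℕ → Set (ι → ℝ)}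
    (hO : ∀ k, O (k + 1) = O k ∩ {x | A *ᵥ x ∈ O k})
    {S : ℕ → Set (Matrix (ι ⊕ Unit) (ι ⊕ Unit) ℝ)}
    (hS : ∀ k, S (k + 1) = S k ∪
      (fun M => (Matrix.fromBlocks A 0 0 1)ᵀ * M * Matrix.fromBlocks A 0 0 1) '' S k)
    (h0 : ∀ M ∈ S 0, ∀ x ∈ O 0, homogenizedForm M x ≤ 0) (k : ℕ) :
    ∀ M ∈ S k, ∀ x ∈ O k, homogenizedForm M x ≤ 0 := by
  induction k with
  | zero => exact h0
  | succ k ih =>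
    intro M hM x hx
    rw [hO] at hx
    rw [hS] at hM
    rcases hM with hM | ⟨N, hN, rfl⟩
    · exact ih M hM x hx.1
    · exact (homogenizedForm_congruence _ N (fromBlocks_one_mulVec_homogenize A x)).trans_le
        (ih N hN _ hx.2)

end homogenizedForm

/-- S-procedure with nonlinear constraints, nonlinear part: assuming the two-sided
quadratic bound holds globally, if (Ā^{k+1})ᵀ H̄_i^u Ā^{k+1} is dominated by an element
of cone(𝒬_k ∪ ℋ^l_k), then H_i(A^{k+1} x) ≤ 1 for every x ∈ O_k. -/
theorem sProcedure_nonlinear_part (n p m : ℕ)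
    (A : Matrix (Fin n) (Fin n) ℝ)
    (Q : Fin p → Matrix (Fin n) (Fin n) ℝ) (q : Fin p → Fin n → ℝ)
    (hQsymm : ∀ i, (Q i)ᵀ = Q i)
    (Ω : Set (Fin n → ℝ))
    (hΩ : Ω = {x : Fin n → ℝ | ∀ i : Fin p, x ⬝ᵥ (Q i).mulVec x + 2 * (q i ⬝ᵥ x) ≤ 1})
    (H : Fin m → (Fin n → ℝ) → ℝ)
    (hHcont : ∀ i, Continuous (H i)) (hH0 : ∀ i, H i 0 = 0)
    (G : Fin m → Fin n → ℝ) (L : Fin m → ℝ) (hL : ∀ i, 0 ≤ L i)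
    (hquasi : ∀ i : Fin m, ∀ x : Fin n → ℝ,
      |H i x - H i 0 - G i ⬝ᵥ x| ≤ L i / 2 * (x ⬝ᵥ x))
    (Θ : Set (Fin n → ℝ)) (hΘ : Θ = {x : Fin n → ℝ | ∀ i : Fin m, H i x ≤ 1})
    (X : Set (Fin n → ℝ)) (hX : X = Ω ∩ Θ)
    (O : ℕ → Set (Fin n → ℝ)) (hO0 : O 0 = X)
    (hOsucc : ∀ k : ℕ, O (k + 1) = O k ∩ {x : Fin n → ℝ | A.mulVec x ∈ O k})
    (Abar : Matrix (Fin n ⊕ Unit) (Fin n ⊕ Unit) ℝ)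
    (hAbar : Abar = Matrix.fromBlocks A 0 0 1)
    (Qbar : Fin p → Matrix (Fin n ⊕ Unit) (Fin n ⊕ Unit) ℝ)
    (hQbar : ∀ i, Qbar i = Matrix.fromBlocks (Q i) (Matrix.of fun r (_ : Unit) => q i r)
      (Matrix.of fun (_ : Unit) c => q i c) (Matrix.of fun (_ : Unit) (_ : Unit) => (-1 : ℝ)))
    (Hubar : Fin m → Matrix (Fin n ⊕ Unit) (Fin n ⊕ Unit) ℝ)
    (hHubar : ∀ i, Hubar i = Matrix.fromBlocks ((L i / 2) • (1 : Matrix (Fin n) (Fin n) ℝ))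
      (Matrix.of fun r (_ : Unit) => G i r / 2)
      (Matrix.of fun (_ : Unit) c => G i c / 2)
      (Matrix.of fun (_ : Unit) (_ : Unit) => H i 0 - 1))
    (Hlbar : Fin m → Matrix (Fin n ⊕ Unit) (Fin n ⊕ Unit) ℝ)
    (hHlbar : ∀ i, Hlbar i = Matrix.fromBlocks (-(L i / 2) • (1 : Matrix (Fin n) (Fin n) ℝ))
      (Matrix.of fun r (_ : Unit) => G i r / 2)
      (Matrix.of fun (_ : Unit) c => G i c / 2)
      (Matrix.of fun (_ : Unit) (_ : Unit) => H i 0 - 1))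
    (𝒬 : ℕ → Set (Matrix (Fin n ⊕ Unit) (Fin n ⊕ Unit) ℝ))
    (h𝒬0 : 𝒬 0 = Set.range Qbar)
    (h𝒬succ : ∀ k : ℕ, 𝒬 (k + 1) = 𝒬 k ∪ (fun M => Abarᵀ * M * Abar) '' 𝒬 k)
    (ℋl : ℕ → Set (Matrix (Fin n ⊕ Unit) (Fin n ⊕ Unit) ℝ))
    (hℋl0 : ℋl 0 = Set.range Hlbar)
    (hℋlsucc : ∀ k : ℕ, ℋl (k + 1) = ℋl k ∪ (fun M => Abarᵀ * M * Abar) '' ℋl k)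
    (k : ℕ) (i : Fin m)
    (hfeas : ∃ M ∈ matCone (𝒬 k ∪ ℋl k),
      (M - (Abar ^ (k + 1))ᵀ * Hubar i * Abar ^ (k + 1)).PosSemidef) :
    ∀ x ∈ O k, H i ((A ^ (k + 1)).mulVec x) ≤ 1 := by
  subst hAbar
  have hQ0 : ∀ M ∈ 𝒬 0, ∀ x ∈ O 0, homogenizedForm M x ≤ 0 := by
    rw [h𝒬0, hO0, hX, hΩ]
    rintro _ ⟨j, rfl⟩ x hx
    rw [hQbar, homogenizedForm_fromBlocks]
    linarith [hx.1 j]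
  have hform (a : ℝ) (j : Fin m) (x : Fin n → ℝ) :
      homogenizedForm (Matrix.fromBlocks (a • (1 : Matrix (Fin n) (Fin n) ℝ))
        (Matrix.of fun r (_ : Unit) => G j r / 2) (Matrix.of fun (_ : Unit) c => G j c / 2)
        (Matrix.of fun (_ : Unit) (_ : Unit) => H j 0 - 1)) x =
        a * (x ⬝ᵥ x) + G j ⬝ᵥ x + (H j 0 - 1) := by
    rw [homogenizedForm_fromBlocks _ (fun r => G j r / 2), smul_mulVec, one_mulVec,
      dotProduct_smul, smul_eq_mul]
    simp only [dotProduct, Finset.mul_sum]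
    congr 2
    exact Finset.sum_congr rfl fun r _ => by ring
  have hH0' : ∀ M ∈ ℋl 0, ∀ x ∈ O 0, homogenizedForm M x ≤ 0 := by
    rw [hℋl0, hO0, hX, hΘ]
    rintro _ ⟨j, rfl⟩ x hx
    rw [hHlbar, hform]
    linarith [hx.2 j, (abs_le.mp (hquasi j x)).1]
  intro x hx
  obtain ⟨M, hM, hle⟩ := hfeas
  have hMx : homogenizedForm M x ≤ 0 := homogenizedForm_nonpos_of_mem_matCone
    (fun N hN => hN.elim
      (fun h => homogenizedForm_nonpos_of_pullback A hOsucc h𝒬succ hQ0 k N h x hx)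
      (fun h => homogenizedForm_nonpos_of_pullback A hOsucc hℋlsucc hH0' k N h x hx)) hM
  have hu := (homogenizedForm_le_of_posSemidef_sub hle x).trans hMx
  rw [homogenizedForm_congruence _ _ (fromBlocks_one_pow_mulVec_homogenize A (k + 1) x), hHubar,
    hform] at hu
  linarith [(abs_le.mp (hquasi i ((A ^ (k + 1)) *ᵥ x))).2]
end

section
/- (Nonlinear systems, finite determination.) Let f : ℝ^n → ℝ^n and X ⊆ ℝ^n. Define O_0 := X and O_{k+1} := O_k ∩ {x : f(x) ∈ O_k}, and let f^k denote the k-fold iterate of f with f^0 = id. Suppose there exists k* ≥ 1 such that f^{k*}(x) ∈ X for every x ∈ X (which, in the paper, is deduced from asymptotic stability of the origin on the compact set X). Then O_{k*} is invariant under f (x ∈ O_{k*} implies f(x) ∈ O_{k*}), O_k = O_{k*} for all k ≥ k*, and the maximal constraint-admissible invariant set O_∞ := ∩_{k ∈ ℕ} O_k = {x : f^k(x) ∈ X for all k ∈ ℕ} equals O_{k*}. -/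
/-- Membership in the `k`-th set of the recursion means that the first `k` iterates stay in `X`. -/
theorem mem_recursion_iff_iterate_mem {α : Type*} {f : α → α} {X : Set α} {O : ℕ → Set α}
    (hO0 : O 0 = X) (hOsucc : ∀ k, O (k + 1) = O k ∩ {x | f x ∈ O k}) (k : ℕ) (x : α) :
    x ∈ O k ↔ ∀ j ≤ k, f^[j] x ∈ X := by
  induction k generalizing x with
  | zero => simp [hO0]
  | succ k ih =>
    rw [hOsucc, Set.mem_inter_iff, Set.mem_ofPred_eq, ih, ih]
    constructor
    · rintro ⟨hx, hfx⟩ (_ | j) hj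
      · exact hx 0 (Nat.zero_le k)
      · exact hfx j (Nat.le_of_succ_le_succ hj)
    · exact fun h => ⟨fun j hj => h j (by omega), fun j hj => h (j + 1) (by omega)⟩

/-- If the `m`-th iterate maps `X` into itself, an orbit that stays in `X` up to time `m`
stays in `X` forever. -/
theorem iterate_mem_of_forall_le {α : Type*} {f : α → α} {X : Set α} {m : ℕ} (hm : 1 ≤ m)
    (hreturn : ∀ x ∈ X, f^[m] x ∈ X) {x : α} (hx : ∀ j ≤ m, f^[j] x ∈ X) (j : ℕ) :
    f^[j] x ∈ X := by
  induction j using Nat.strong_induction_on with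
  | _ j ih =>
    rcases le_total j m with hj | hj
    · exact hx j hj
    · have h := hreturn _ (ih (j - m) (by omega))
      rwa [← Function.iterate_add_apply, Nat.add_sub_cancel' hj] at h

/-- Nonlinear systems, finite determination: if f^{k*}(x) ∈ X for every x ∈ X for some
k* ≥ 1, then O_{k*} is invariant under f, O_k = O_{k*} for all k ≥ k*, and the maximal
constraint-admissible invariant set O_∞ = ⋂_k O_k = {x : f^k(x) ∈ X ∀ k} equals O_{k*}. -/
theorem nonlinear_finite_determination (n : ℕ)
    (f : (Fin n → ℝ) → (Fin n → ℝ)) (X : Set (Fin n → ℝ))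
    (O : ℕ → Set (Fin n → ℝ)) (hO0 : O 0 = X)
    (hOsucc : ∀ k : ℕ, O (k + 1) = O k ∩ {x : Fin n → ℝ | f x ∈ O k})
    (kstar : ℕ) (hkstar : 1 ≤ kstar)
    (hreturn : ∀ x ∈ X, f^[kstar] x ∈ X) :
    (∀ x ∈ O kstar, f x ∈ O kstar) ∧
    (∀ k : ℕ, kstar ≤ k → O k = O kstar) ∧
    (⋂ k : ℕ, O k) = {x : Fin n → ℝ | ∀ k : ℕ, f^[k] x ∈ X} ∧
    (⋂ k : ℕ, O k) = O kstar := by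
  have hmem := mem_recursion_iff_iterate_mem hO0 hOsucc
  have hall : ∀ x ∈ O kstar, ∀ j, f^[j] x ∈ X := fun x hx =>
    iterate_mem_of_forall_le hkstar hreturn ((hmem kstar x).1 hx)
  refine ⟨fun x hx => (hmem _ _).2 fun j _ => hall x hx (j + 1), fun k hk => ?_, ?_, ?_⟩
  · ext x
    exact ⟨fun hx => (hmem _ _).2 fun j hj => (hmem _ _).1 hx j (hj.trans hk),
      fun hx => (hmem _ _).2 fun j _ => hall x hx j⟩
  · ext x
    rw [Set.mem_iInter, Set.mem_ofPred_eq]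
    exact ⟨fun hx k => (hmem _ _).1 (hx k) k le_rfl, fun hx k => (hmem _ _).2 fun j _ => hx j⟩
  · exact (Set.iInter_subset O kstar).antisymm fun x hx =>
      Set.mem_iInter.2 fun k => (hmem _ _).2 fun j _ => hall x hx j
end
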